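/- Schoenberg's theorem applied to ℓᵖ: for 1 ≤ p ≤ 2, the function x ↦ exp(−‖x‖ᵖ) is positive definite on the additive group of ℓᵖ, and consequently the additive group of ℓᵖ is isomorphic to a closed topological subgroup of the unitary group U(ℓ²) with the strong operator topology. -/

import Mathlib

open scoped ComplexOrder

/-- A separable infinite-dimensional complex Hilbert space: `ℓ²(ℕ, ℂ)`. -/
noncomputable abbrev ellTwo : Type := lp (fun _ : ℕ => ℂ) 2

/-- The full unitary group of the separable Hilbert space `ℓ²`. -/
def UnitarySOT : Type := unitary (ellTwo →L[ℂ] ellTwo)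

noncomputable instance : Group UnitarySOT :=
  inferInstanceAs (Group (unitary (ellTwo →L[ℂ] ellTwo)))

/-- The strong operator topology on the unitary group: the topology of
pointwise convergence on vectors of the Hilbert space. -/
noncomputable instance : TopologicalSpace UnitarySOT :=
  TopologicalSpace.induced
    (fun (u : unitary (ellTwo →L[ℂ] ellTwo)) (v : ellTwo) =>
      (u : ellTwo →L[ℂ] ellTwo) v)
    Pi.topologicalSpace

/-- A complex-valued function on a group is positive definite if all the
associated finite Hermitian forms are positive semi-definite. -/
def IsPositiveDefinite {G : Type*} [Group G] (f : G → ℂ) : Prop :=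
  ∀ (n : ℕ) (g : Fin n → G) (lam : Fin n → ℂ),
    0 ≤ ∑ i, ∑ j, f (g i * (g j)⁻¹) * lam i * (starRingEnd ℂ) (lam j)

/-- Real kernels that are positive semidefinite. -/
def PK {X : Type*} (k : X → X → ℝ) : Prop :=
  (Matrix.of fun i j => (k i j : ℂ) : Matrix X X ℂ).PosSemidef

section PKsec

variable {X : Type*}

theorem PK_iff (k : X → X → ℝ) : PK k ↔ (∀ i j, k i j = k j i) ∧
    ∀ x : X →₀ ℂ, 0 ≤ ∑ i ∈ x.support, ∑ j ∈ x.support, star (x i) * (k i j : ℂ) * x j := by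
  unfold PK Matrix.PosSemidef
  refine and_congr ?_ ?_
  · rw [Matrix.IsHermitian.ext_iff]
    simp only [Matrix.of_apply]
    constructor
    · intro h i j
      have := h i j
      simp at this
      exact this.symm
    · intro h i j
      simp [h i j]
  · rfl

theorem PK_rank1 (a : X → ℝ) : PK (fun i j => a i * a j) := by
  rw [PK_iff]
  refine ⟨fun i j => mul_comm _ _, fun x => ?_⟩
  have : ∑ i ∈ x.support, ∑ j ∈ x.support, star (x i) * ((a i * a j : ℝ) : ℂ) * x j
      = star (∑ i ∈ x.support, (a i : ℂ) * x i) * (∑ i ∈ x.support, (a i : ℂ) * x i) := by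
    rw [star_sum, Finset.sum_mul_sum]
    refine Finset.sum_congr rfl fun i _ => Finset.sum_congr rfl fun j _ => ?_
    simp
    ring
  rw [this]
  exact star_mul_self_nonneg _

theorem PK.add {k l : X → X → ℝ} (hk : PK k) (hl : PK l) : PK (fun i j => k i j + l i j) := by
  have := Matrix.PosSemidef.add hk hl
  unfold PK
  convert this using 1
  ext i j
  simp

theorem PK.mul {k l : X → X → ℝ} (hk : PK k) (hl : PK l) : PK (fun i j => k i j * l i j) := by
  have h : (Matrix.of fun i j => ((k i j * l i j : ℝ) : ℂ) : Matrix X X ℂ) =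
      Matrix.hadamard (Matrix.of fun i j => (k i j : ℂ)) (Matrix.of fun i j => (l i j : ℂ)) := by
    ext i j
    simp
  unfold PK
  rw [h]
  exact Matrix.PosSemidef.hadamard hk hl

theorem PK.congr {k l : X → X → ℝ} (hk : PK k) (h : ∀ i j, l i j = k i j) : PK l := by
  have : l = k := by ext i j; exact h i j
  rwa [this]

theorem PK_const {c : ℝ} (hc : 0 ≤ c) : PK (fun _ _ : X => c) :=
  (PK_rank1 (fun _ : X => √c)).congr fun _ _ => (Real.mul_self_sqrt hc).symm

theorem PK.comp {Y : Type*} {k : X → X → ℝ} (hk : PK k) (e : Y → X) :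
    PK (fun i j => k (e i) (e j)) :=
  Matrix.PosSemidef.submatrix hk e

theorem PK.sum {ι : Type*} {k : ι → X → X → ℝ} (s : Finset ι) (hk : ∀ n, PK (k n)) :
    PK (fun i j => ∑ n ∈ s, k n i j) := by
  classical
  induction s using Finset.induction_on with
  | empty => simpa using PK_const (X := X) le_rfl
  | insert a s ha ih => 
    refine ((hk a).add ih).congr fun i j => ?_
    rw [Finset.sum_insert ha]

theorem PK.lim {ι : Type*} {F : Filter ι} [F.NeBot] {k : ι → X → X → ℝ} {l : X → X → ℝ}
    (hk : ∀ n, PK (k n)) (hl : ∀ i j, Filter.Tendsto (fun n => k n i j) F (nhds (l i j))) :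
    PK l := by
  simp only [PK_iff] at hk ⊢
  refine ⟨fun i j => ?_, fun x => ?_⟩
  · refine tendsto_nhds_unique (hl i j) ?_
    simp only [fun n => (hk n).1 i j]
    exact hl j i
  · refine ge_of_tendsto' (f := fun n => ∑ i ∈ x.support, ∑ j ∈ x.support,
      star (x i) * (k n i j : ℂ) * x j) (x := F) ?_ fun n => (hk n).2 x
    refine tendsto_finsetSum _ fun i _ => tendsto_finsetSum _ fun j _ => ?_
    exact (((Complex.continuous_ofReal.tendsto _).comp (hl i j)).const_mul _).mul_const _

theorem PK.exp {k : X → X → ℝ} (hk : PK k) : PK (fun i j => Real.exp (k i j)) := by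
  have hpow : ∀ n : ℕ, PK (fun i j => (k i j) ^ n) := by
    intro n
    induction n with
    | zero => simpa using PK_const (X := X) zero_le_one
    | succ n ih => exact (ih.mul hk).congr fun i j => pow_succ _ _
  refine PK.lim (F := Filter.atTop)
    (k := fun (N : ℕ) i j => ∑ n ∈ Finset.range N, (k i j) ^ n * ((n.factorial : ℝ)⁻¹))
    (fun N => PK.sum _ fun n => (hpow n).mul (PK_const (by positivity))) fun i j => ?_
  have := (NormedSpace.expSeries_div_hasSum_exp (𝔸 := ℝ) (k i j)).tendsto_sum_nat
  rw [← Real.exp_eq_exp_ℝ] at this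
  simpa only [div_eq_mul_inv] using this

theorem PK.integral {α : Type*} [MeasurableSpace α] {μ : MeasureTheory.Measure α}
    {k : α → X → X → ℝ} (hk : ∀ u, PK (k u))
    (hi : ∀ i j, MeasureTheory.Integrable (fun u => k u i j) μ) :
    PK (fun i j => ∫ u, k u i j ∂μ) := by
  simp only [PK_iff] at hk ⊢
  refine ⟨fun i j => ?_, fun x => ?_⟩
  · simp only [fun n => (hk n).1 i j]
  · have hint : ∀ i j, MeasureTheory.Integrable
        (fun u => star (x i) * (k u i j : ℂ) * x j) μ := fun i j =>
      ((hi i j).ofReal.const_mul _).mul_const _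
    have : ∑ i ∈ x.support, ∑ j ∈ x.support, star (x i) * ((∫ u, k u i j ∂μ : ℝ) : ℂ) * x j
      = ∫ u, ∑ i ∈ x.support, ∑ j ∈ x.support, star (x i) * (k u i j : ℂ) * x j ∂μ := by
      rw [MeasureTheory.integral_finsetSum _ fun i _ =>
        MeasureTheory.integrable_finsetSum _ fun j _ => hint i j]
      refine Finset.sum_congr rfl fun i _ => ?_
      rw [MeasureTheory.integral_finsetSum _ fun j _ => hint i j]
      refine Finset.sum_congr rfl fun j _ => ?_
      rw [MeasureTheory.integral_mul_const, MeasureTheory.integral_const_mul, integral_complex_ofReal]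
    rw [this]
    exact MeasureTheory.integral_nonneg fun u => (hk u).2 x

end PKsec

section frac

open MeasureTheory Set

theorem frac_integrable {p : ℝ} (h0 : 0 < p) (h2 : p < 2) (t : ℝ) :
    Integrable (fun u : ℝ => (1 - Real.cos (t * u)) * u ^ (-1 - p)) (volume.restrict (Ioi 0)) := by
  have hm : ∀ μ : Measure ℝ, AEStronglyMeasurable
      (fun u : ℝ => (1 - Real.cos (t * u)) * u ^ (-1 - p)) μ := by
    intro μ
    apply Measurable.aestronglyMeasurable
    fun_prop
  have : Ioi (0:ℝ) = Ioc 0 1 ∪ Ioi 1 := by rw [Ioc_union_Ioi_eq_Ioi]; norm_num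
  change IntegrableOn _ _ _
  rw [this]
  refine IntegrableOn.union ?_ ?_
  · have h1 : IntegrableOn (fun u : ℝ => (t ^ 2 / 2) * u ^ (1 - p)) (Ioc 0 1) := by
      have := (intervalIntegral.intervalIntegrable_rpow' (a := 0) (b := 1) (r := 1 - p)
        (by linarith)).const_mul (t ^ 2 / 2)
      rwa [intervalIntegrable_iff_integrableOn_Ioc_of_le zero_le_one] at this
    refine Integrable.mono' h1 (hm _) ?_
    refine (ae_restrict_iff' measurableSet_Ioc).2 (ae_of_all _ fun u hu => ?_)
    have hu0 : 0 < u := hu.1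
    have h3 : 0 ≤ 1 - Real.cos (t * u) := by linarith [Real.cos_le_one (t * u)]
    rw [Real.norm_of_nonneg (by positivity)]
    have h4 := Real.one_sub_sq_div_two_le_cos (x := t * u)
    have h5 : u ^ (1 - p) = u ^ 2 * u ^ (-1 - p) := by
      rw [← Real.rpow_natCast, ← Real.rpow_add hu0]; norm_num; ring_nf
    rw [h5, ← mul_assoc]
    gcongr
    nlinarith
  · have h1 := (integrableOn_Ioi_rpow_of_lt (a := -1 - p) (by linarith) zero_lt_one).const_mul 2
    refine Integrable.mono' h1 (hm _) ?_
    refine (ae_restrict_iff' measurableSet_Ioi).2 (ae_of_all _ fun u hu => ?_)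
    have hu0 : 0 < u := lt_trans zero_lt_one hu
    have h3 : 0 ≤ 1 - Real.cos (t * u) := by linarith [Real.cos_le_one (t * u)]
    rw [Real.norm_of_nonneg (by positivity)]
    gcongr
    linarith [Real.neg_one_le_cos (t * u)]

theorem frac_pos {p : ℝ} (h0 : 0 < p) (h2 : p < 2) :
    0 < ∫ u in Ioi (0:ℝ), (1 - Real.cos u) * u ^ (-1 - p) := by
  have hi := frac_integrable h0 h2 1
  simp only [one_mul] at hi
  have hnn : ∀ u ∈ Ioi (0:ℝ), 0 ≤ (1 - Real.cos u) * u ^ (-1 - p) := fun u hu => by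
    have h3 : 0 ≤ 1 - Real.cos u := by linarith [Real.cos_le_one u]
    have : 0 < u := hu
    positivity
  rw [setIntegral_pos_iff_support_of_nonneg_ae
    ((ae_restrict_iff' measurableSet_Ioi).2 (ae_of_all _ hnn)) hi]
  refine lt_of_lt_of_le ?_ (measure_mono (s := Ioo (0:ℝ) 1) ?_)
  · simp
  · intro u hu
    refine ⟨?_, hu.1⟩
    have h1 : Real.cos u < 1 := by
      rw [← Real.cos_zero]
      exact Real.cos_lt_cos_of_nonneg_of_le_pi le_rfl (by linarith [hu.2, Real.pi_gt_three]) hu.1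
    have : 0 < u ^ (-1 - p) := Real.rpow_pos_of_pos hu.1 _
    exact (mul_pos (by linarith) this).ne'

theorem frac_eq {p : ℝ} (h0 : 0 < p) (t : ℝ) :
    ∫ u in Ioi (0:ℝ), (1 - Real.cos (t * u)) * u ^ (-1 - p) =
      (∫ u in Ioi (0:ℝ), (1 - Real.cos u) * u ^ (-1 - p)) * |t| ^ p := by
  rcases eq_or_ne t 0 with rfl | ht
  · simp [Real.zero_rpow h0.ne']
  have ha : 0 < |t| := abs_pos.2 ht
  have h1 := integral_comp_mul_left_Ioi (fun u : ℝ => (1 - Real.cos u) * u ^ (-1 - p)) 0 ha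
  rw [mul_zero, smul_eq_mul] at h1
  have h2 : ∫ u in Ioi (0:ℝ), (1 - Real.cos (|t| * u)) * (|t| * u) ^ (-1 - p)
      = |t| ^ (-1 - p) * ∫ u in Ioi (0:ℝ), (1 - Real.cos (t * u)) * u ^ (-1 - p) := by
    rw [← integral_const_mul]
    refine setIntegral_congr_fun measurableSet_Ioi fun u hu => ?_
    have hu0 : 0 < u := hu
    have hc : Real.cos (|t| * u) = Real.cos (t * u) := by
      rw [← Real.cos_abs (t * u), abs_mul, abs_of_pos hu0]
    simp only [hc]
    rw [Real.mul_rpow ha.le hu0.le]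
    ring
  rw [h2] at h1
  have h3 : |t| ^ (-1 - p) = |t|⁻¹ * (|t| ^ p)⁻¹ := by
    rw [Real.rpow_sub ha, Real.rpow_neg_one]; rfl
  rw [h3] at h1
  have h4 : |t| ^ p ≠ 0 := (Real.rpow_pos_of_pos ha _).ne'
  field_simp at h1
  linarith

theorem PK_frac {p : ℝ} (h0 : 0 < p) (h2 : p ≤ 2) :
    PK (fun s t : ℝ => |s| ^ p + |t| ^ p - |s - t| ^ p) := by
  rcases h2.eq_or_lt with rfl | h2
  · refine ((PK_rank1 (fun t : ℝ => t)).mul (PK_const (c := 2) (by norm_num))).congr fun s t => ?_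
    norm_num [sq_abs]
    ring
  set C := ∫ u in Ioi (0:ℝ), (1 - Real.cos u) * u ^ (-1 - p) with hC
  have hCpos : 0 < C := frac_pos h0 h2
  have key : PK (fun s t : ℝ => ∫ u in Ioi (0:ℝ),
      ((1 - Real.cos (s * u)) * u ^ (-1 - p) + (1 - Real.cos (t * u)) * u ^ (-1 - p)
        - (1 - Real.cos ((s - t) * u)) * u ^ (-1 - p))) := by
    have hpt : ∀ u : ℝ, 0 < u → PK (fun s t : ℝ =>
      ((1 - Real.cos (s * u)) * u ^ (-1 - p) + (1 - Real.cos (t * u)) * u ^ (-1 - p)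
        - (1 - Real.cos ((s - t) * u)) * u ^ (-1 - p))) := by
      intro u hu
      refine (((PK_rank1 (fun t : ℝ => 1 - Real.cos (t * u))).add
        (PK_rank1 (fun t : ℝ => Real.sin (t * u)))).mul
        (PK_const (c := u ^ (-1 - p)) (by positivity))).congr fun s t => ?_
      rw [sub_mul s t u, Real.cos_sub]
      ring
    have h5 : PK (fun s t : ℝ => ∫ u in Ioi (0:ℝ), (Ioi (0:ℝ)).indicator (fun u => 
      ((1 - Real.cos (s * u)) * u ^ (-1 - p) + (1 - Real.cos (t * u)) * u ^ (-1 - p)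
        - (1 - Real.cos ((s - t) * u)) * u ^ (-1 - p))) u) := by
      refine PK.integral (fun u => ?_) fun s t => ?_
      · by_cases hu : 0 < u
        · refine (hpt u hu).congr fun s t => ?_
          rw [indicator_of_mem (by exact hu)]
        · refine (PK_const le_rfl).congr fun s t => ?_
          rw [indicator_of_notMem (by exact hu)]
      · refine Integrable.indicator ?_ measurableSet_Ioi
        exact ((frac_integrable h0 h2 s).add (frac_integrable h0 h2 t)).sub
          (frac_integrable h0 h2 (s - t))
    refine h5.congr fun s t => ?_
    rw [setIntegral_indicator measurableSet_Ioi, inter_self]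
  refine (key.mul (PK_const (c := C⁻¹) (by positivity))).congr fun s t => ?_
  have h6 : Integrable (fun u : ℝ => (1 - Real.cos (s * u)) * u ^ (-1 - p)
      + (1 - Real.cos (t * u)) * u ^ (-1 - p)) (volume.restrict (Ioi 0)) :=
    (frac_integrable h0 h2 s).add (frac_integrable h0 h2 t)
  rw [integral_sub h6 (frac_integrable h0 h2 (s - t)), integral_add (frac_integrable h0 h2 s)
    (frac_integrable h0 h2 t), frac_eq h0, frac_eq h0, frac_eq h0, ← hC]
  field_simp

end frac

section lpPD

open scoped ENNReal

theorem PK_lp (p : ℝ≥0∞) [Fact (1 ≤ p)] (hp2 : p ≤ 2) :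
    PK (fun x y : lp (fun _ : ℕ => ℝ) p => Real.exp (-(‖x - y‖ ^ p.toReal))) := by
  have htop : p ≠ ⊤ := ne_top_of_le_ne_top (by simp) hp2
  have h1 : 0 < p.toReal :=
    ENNReal.toReal_pos (lt_of_lt_of_le zero_lt_one (Fact.out : 1 ≤ p)).ne' htop
  have h2 : p.toReal ≤ 2 := by
    simpa using ENNReal.toReal_mono (by simp) hp2
  have key : PK (fun x y : lp (fun _ : ℕ => ℝ) p =>
      ‖x‖ ^ p.toReal + ‖y‖ ^ p.toReal - ‖x - y‖ ^ p.toReal) := by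
    refine PK.lim (F := Filter.atTop) (k := fun (N : ℕ) (x y : lp (fun _ : ℕ => ℝ) p) =>
      ∑ n ∈ Finset.range N, (|x n| ^ p.toReal + |y n| ^ p.toReal - |x n - y n| ^ p.toReal))
      (fun N => PK.sum _ fun n => (PK_frac h1 h2).comp fun x : lp (fun _ : ℕ => ℝ) p => x n)
      fun x y => ?_
    have := (((lp.hasSum_norm h1 x).add (lp.hasSum_norm h1 y)).sub
      (lp.hasSum_norm h1 (x - y))).tendsto_sum_nat
    simpa using this
  refine ((PK_rank1 (fun x : lp (fun _ : ℕ => ℝ) p => Real.exp (-(‖x‖ ^ p.toReal)))).mul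
    key.exp).congr fun x y => ?_
  rw [← Real.exp_add, ← Real.exp_add]
  congr 1
  ring

theorem PK.fin {X : Type*} {k : X → X → ℝ} (hk : PK k) (n : ℕ) (g : Fin n → X)
    (lam : Fin n → ℂ) :
    0 ≤ ∑ i, ∑ j, (k (g i) (g j) : ℂ) * lam i * (starRingEnd ℂ) (lam j) := by
  have h := Matrix.PosSemidef.dotProduct_mulVec_nonneg (hk.comp g) lam
  have hs := ((PK_iff k).1 hk).1
  refine h.trans_eq ?_
  simp only [dotProduct, Matrix.mulVec, Finset.mul_sum]
  rw [Finset.sum_comm]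
  refine Finset.sum_congr rfl fun i _ => Finset.sum_congr rfl fun j _ => ?_
  simp only [Matrix.of_apply, Pi.star_apply, hs (g j) (g i), RCLike.star_def]
  ring

end lpPD
section GNS

open scoped InnerProductSpace

theorem exists_feature {X : Type} {k : X → X → ℝ} (hk : PK k) :
    ∃ (H : Type) (_ : NormedAddCommGroup H) (_ : InnerProductSpace ℂ H) (_ : CompleteSpace H)
      (δ : X → H), (∀ x y, inner ℂ (δ x) (δ y) = (k x y : ℂ)) ∧
        (Submodule.span ℂ (Set.range δ)).topologicalClosure = ⊤ := by
  have hsym := ((PK_iff k).1 hk).1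
  let K : Matrix X X (ℂ →L[ℂ] ℂ) := Matrix.of fun x y => (k x y : ℂ) • (1 : ℂ →L[ℂ] ℂ)
  have hK : K.PosSemidef := by
    have ht := (RKHS.posSemidef_tfae (𝕜 := ℂ) (K := K)).out 0 2
    refine ht.mpr (And.intro ?_ fun vv => ?_)
    · ext x y
      simp [K, Matrix.conjTranspose_apply, hsym x y]
    · have h1 := ((PK_iff k).1 hk).2 vv
      have h2 := (Complex.le_def.1 h1).1
      refine h2.trans_eq ?_
      simp only [Finsupp.sum]
      congr 1
      refine Finset.sum_congr rfl fun i _ => Finset.sum_congr rfl fun j _ => ?_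
      simp [K, hsym i j]
      ring
  have : Fact K.PosSemidef := ⟨hK⟩
  refine ⟨RKHS.OfKernel K, inferInstance, inferInstance, inferInstance,
    fun x => RKHS.kerFun (RKHS.OfKernel K) x 1, fun x y => ?_, ?_⟩
  · rw [← RKHS.kernel_inner, RKHS.OfKernel.kernel_ofKernel]
    simp [K, hsym x y]
  · have := RKHS.kerFun_dense (H := RKHS.OfKernel K)
    rw [eq_top_iff, ← this]
    refine Submodule.topologicalClosure_mono (Submodule.span_le.2 ?_)
    rintro _ ⟨x, v, rfl⟩
    have h : RKHS.kerFun (RKHS.OfKernel K) x v = v • RKHS.kerFun (RKHS.OfKernel K) x 1 := by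
      rw [← map_smul]; simp
    rw [h]
    exact Submodule.smul_mem _ _ (Submodule.subset_span ⟨x, rfl⟩)

theorem exists_ellTwo_equiv {H : Type} [NormedAddCommGroup H] [InnerProductSpace ℂ H]
    [CompleteSpace H] [TopologicalSpace.SeparableSpace H] (hinf : ¬ FiniteDimensional ℂ H) :
    Nonempty (H ≃ₗᵢ[ℂ] ellTwo) := by
  obtain ⟨w, b, hb⟩ := exists_hilbertBasis ℂ H
  have hc : Countable w := by
    refine Pairwise.countable_of_isOpen_disjoint (α := H)
      (s := fun i : w => Metric.ball (b i) (1/2)) ?_ (fun i => Metric.isOpen_ball)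
      (fun i => ⟨b i, Metric.mem_ball_self (by norm_num)⟩)
    intro i j hij
    refine Metric.ball_disjoint_ball ?_
    have h1 : ‖b i - b j‖ ^ 2 = 2 := by
      rw [@norm_sub_sq ℂ, b.orthonormal.1 i, b.orthonormal.1 j, b.orthonormal.2 hij]
      norm_num
    rw [dist_eq_norm]
    nlinarith [norm_nonneg (b i - b j)]
  have hi : Infinite w := by
    by_contra hfin
    rw [not_infinite_iff_finite] at hfin
    have := Fintype.ofFinite w
    exact hinf (b.toOrthonormalBasis.toBasis.finiteDimensional_of_finite)
  obtain ⟨e⟩ := nonempty_equiv_of_countable (α := ℕ) (β := w)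
  have ho : Orthonormal ℂ (b ∘ e) := b.orthonormal.comp e e.injective
  refine ⟨(HilbertBasis.mk ho ?_).repr⟩
  rw [e.surjective.range_comp, b.dense_span]

variable {G : Type} [NormedAddCommGroup G]

theorem norm_lc_eq {X H : Type} [NormedAddCommGroup H] [InnerProductSpace ℂ H] {δ δ' : X → H}
    (h : ∀ x y, inner ℂ (δ x) (δ y) = inner ℂ (δ' x) (δ' y)) (x : X →₀ ℂ) :
    ‖Finsupp.linearCombination ℂ δ x‖ = ‖Finsupp.linearCombination ℂ δ' x‖ := by
  have : inner ℂ (Finsupp.linearCombination ℂ δ x) (Finsupp.linearCombination ℂ δ x)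
      = inner ℂ (Finsupp.linearCombination ℂ δ' x) (Finsupp.linearCombination ℂ δ' x) := by
    simp only [Finsupp.linearCombination_apply, Finsupp.sum, sum_inner, inner_sum,
      inner_smul_left, inner_smul_right, h]
  rw [inner_self_eq_norm_sq_to_K, inner_self_eq_norm_sq_to_K] at this
  have h2 : ‖Finsupp.linearCombination ℂ δ x‖ ^ 2 = ‖Finsupp.linearCombination ℂ δ' x‖ ^ 2 := by
    exact_mod_cast this
  exact (sq_eq_sq₀ (norm_nonneg _) (norm_nonneg _)).1 h2

theorem dense_lc {X H : Type} [NormedAddCommGroup H] [InnerProductSpace ℂ H] {δ : X → H}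
    (h : (Submodule.span ℂ (Set.range δ)).topologicalClosure = ⊤) :
    DenseRange (Finsupp.linearCombination ℂ δ) := by
  rw [DenseRange, ← LinearMap.coe_range, Finsupp.range_linearCombination,
    Submodule.dense_iff_topologicalClosure_eq_top]
  exact h

theorem exists_rep {H : Type} [NormedAddCommGroup H] [InnerProductSpace ℂ H] [CompleteSpace H]
    {δ : G → H} (hd : (Submodule.span ℂ (Set.range δ)).topologicalClosure = ⊤)
    (hinv : ∀ a x y, inner ℂ (δ (a + x)) (δ (a + y)) = inner ℂ (δ x) (δ y))
    (hcont : Continuous δ) :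
    ∃ π : G → (H ≃ₗᵢ[ℂ] H), (∀ a x, π a (δ x) = δ (a + x)) ∧
      (∀ a b v, π (a + b) v = π a (π b v)) ∧ ∀ v, Continuous fun a => π a v := by
  have hd' := dense_lc hd
  let π : G → (H ≃ₗᵢ[ℂ] H) := fun a =>
    LinearEquiv.extendOfIsometry (Finsupp.domLCongr (Equiv.addLeft a))
      (Finsupp.linearCombination ℂ δ) (Finsupp.linearCombination ℂ δ) hd' hd' (by
        intro x
        rw [← norm_lc_eq (hinv a) x, Finsupp.domLCongr_apply, Finsupp.domCongr_apply,
          Finsupp.linearCombination_equivMapDomain]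
        rfl)
  have h1 : ∀ a x, π a (δ x) = δ (a + x) := by
    intro a x
    have := LinearEquiv.extendOfIsometry_eq (Finsupp.domLCongr (Equiv.addLeft a))
      (Finsupp.linearCombination ℂ δ) (Finsupp.linearCombination ℂ δ) hd' hd' (by
        intro x
        rw [← norm_lc_eq (hinv a) x, Finsupp.domLCongr_apply, Finsupp.domCongr_apply,
          Finsupp.linearCombination_equivMapDomain]
        rfl) (Finsupp.single x 1)
    simpa using this
  have h2 : ∀ a x, π a (Finsupp.linearCombination ℂ δ x) =
      Finsupp.linearCombination ℂ (fun y => δ (a + y)) x := by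
    intro a x
    simp only [Finsupp.linearCombination_apply, Finsupp.sum, map_sum, map_smul, h1]
  refine ⟨π, h1, fun a b v => ?_, fun v => ?_⟩
  · refine hd'.induction_on (p := fun v => π (a + b) v = π a (π b v)) v
      (isClosed_eq (π _).continuous ((π a).continuous.comp (π b).continuous)) fun x => ?_
    rw [h2, h2]
    simp only [Finsupp.linearCombination_apply, Finsupp.sum, map_sum, map_smul, h1, add_assoc]
  · refine continuous_of_uniform_approx_of_continuous fun u hu => ?_
    obtain ⟨ε, hε, hu⟩ := Metric.mem_uniformity_dist.1 hu
    obtain ⟨x, hx⟩ := hd'.exists_dist_lt v hε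
    refine ⟨fun a => π a (Finsupp.linearCombination ℂ δ x), ?_, fun a => hu ?_⟩
    · simp only [h2]
      simp only [Finsupp.linearCombination_apply, Finsupp.sum]
      fun_prop
    · rwa [(π a).dist_map]

theorem feature_dist {H : Type} [NormedAddCommGroup H] [InnerProductSpace ℂ H] {r : ℝ}
    (hr : 0 < r) {δ : G → H}
    (hδ : ∀ x y, inner ℂ (δ x) (δ y) = ((Real.exp (-(‖x - y‖ ^ r)) : ℝ) : ℂ)) (x y : G) :
    dist (δ x) (δ y) = √(2 - 2 * Real.exp (-(dist x y ^ r))) := by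
  have h1 : ∀ x, ‖δ x‖ ^ 2 = 1 := by
    intro x
    have := hδ x x
    rw [inner_self_eq_norm_sq_to_K] at this
    simp [Real.zero_rpow hr.ne'] at this
    rcases this with h | h
    · simp [h]
    · have : (-1 : ℝ) = ‖δ x‖ := by exact_mod_cast h.symm
      linarith [norm_nonneg (δ x)]
  rw [dist_eq_norm, dist_eq_norm, eq_comm, Real.sqrt_eq_iff_eq_sq, @norm_sub_sq ℂ, h1, h1, hδ]
  · simp only [RCLike.re_to_complex, Complex.ofReal_re]
    ring
  · have : Real.exp (-(‖x - y‖ ^ r)) ≤ 1 := Real.exp_le_one_iff.2 (by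
      have := Real.rpow_nonneg (norm_nonneg (x - y)) r
      linarith)
    linarith
  · exact norm_nonneg _

theorem feature_inducing {H : Type} [NormedAddCommGroup H] [InnerProductSpace ℂ H] {r : ℝ}
    (hr : 0 < r) {δ : G → H}
    (hδ : ∀ x y, inner ℂ (δ x) (δ y) = ((Real.exp (-(‖x - y‖ ^ r)) : ℝ) : ℂ)) :
    IsUniformInducing δ := by
  have hd := feature_dist hr hδ
  rw [Metric.isUniformInducing_iff]
  constructor
  · rw [Metric.uniformContinuous_iff]
    intro ε hε
    have hc : Continuous fun t : ℝ => √(2 - 2 * Real.exp (-(t ^ r))) := by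
      have := Real.continuous_rpow_const hr.le
      fun_prop
    obtain ⟨η, hη, h⟩ := Metric.continuous_iff.1 hc 0 ε hε
    refine ⟨η, hη, fun {a b} hab => ?_⟩
    have := h (dist a b) (by simpa using hab)
    rw [hd]
    simp [Real.zero_rpow hr.ne'] at this
    exact (abs_of_nonneg (Real.sqrt_nonneg _)).symm.trans_lt this
  · intro η hη
    have hpos : 0 < η ^ r := Real.rpow_pos_of_pos hη r
    refine ⟨√(2 - 2 * Real.exp (-(η ^ r))), Real.sqrt_pos.2 ?_, fun {a b} hab => ?_⟩
    · have : Real.exp (-(η ^ r)) < 1 := by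
        rw [← Real.exp_zero]
        exact Real.exp_lt_exp.2 (by linarith)
      linarith
    · by_contra! hle
      rw [hd] at hab
      refine absurd hab (not_lt.2 (Real.sqrt_le_sqrt ?_))
      have : Real.exp (-(dist a b ^ r)) ≤ Real.exp (-(η ^ r)) := by
        gcongr
      linarith

theorem feature_infinite {H : Type} [NormedAddCommGroup H] [InnerProductSpace ℂ H] {r : ℝ}
    (hr : 0 < r) {δ : G → H}
    (hδ : ∀ x y, inner ℂ (δ x) (δ y) = ((Real.exp (-(‖x - y‖ ^ r)) : ℝ) : ℂ))
    (s : ℕ → G) (hs : ∀ m n, m ≠ n → 1 ≤ dist (s m) (s n)) : ¬ FiniteDimensional ℂ H := by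
  intro hfin
  have : ProperSpace H := FiniteDimensional.proper ℂ H
  have hd := feature_dist hr hδ
  have hb : Bornology.IsBounded (Set.range (δ ∘ s)) := by
    rw [Metric.isBounded_iff]
    refine ⟨√2, ?_⟩
    rintro _ ⟨m, rfl⟩ _ ⟨n, rfl⟩
    simp only [Function.comp, hd]
    refine Real.sqrt_le_sqrt ?_
    linarith [Real.exp_pos (-(dist (s m) (s n) ^ r))]
  obtain ⟨a, -, φ, hφ, hlim⟩ := tendsto_subseq_of_bounded hb (x := δ ∘ s) fun n => ⟨n, rfl⟩
  have hc := hlim.cauchySeq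
  obtain ⟨ε, hε, h⟩ := (Metric.isUniformInducing_iff.1 (feature_inducing hr hδ)).2 1 one_pos
  obtain ⟨N, hN⟩ := Metric.cauchySeq_iff.1 hc ε hε
  have h3 := h (hN N le_rfl (N + 1) (by omega))
  exact absurd h3 (not_lt.2 (hs _ _ (hφ.injective.ne (by omega))))

theorem main_embedding [CompleteSpace G] [TopologicalSpace.SeparableSpace G] {r : ℝ} (hr : 0 < r)
    (hk : PK (fun x y : G => Real.exp (-(‖x - y‖ ^ r))))
    (s : ℕ → G) (hs : ∀ m n, m ≠ n → 1 ≤ dist (s m) (s n)) :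
    ∃ φ : G → UnitarySOT, (∀ a b, φ (a + b) = φ a * φ b) ∧
      Function.Injective φ ∧ Topology.IsInducing φ ∧ IsClosed (Set.range φ) := by
  obtain ⟨H, _, _, _, δ, hδ, hdense⟩ := exists_feature hk
  have hui := feature_inducing hr hδ
  have hcont : Continuous δ := hui.uniformContinuous.continuous
  have : TopologicalSpace.SeparableSpace H := by
    rw [← TopologicalSpace.isSeparable_univ_iff]
    have h1 := ((TopologicalSpace.isSeparable_range hcont).span (R := ℂ)).closure
    rwa [← Submodule.topologicalClosure_coe, hdense] at h1
  obtain ⟨e⟩ := exists_ellTwo_equiv (feature_infinite hr hδ s hs)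
  obtain ⟨π, hπδ, hπadd, hπc⟩ := exists_rep hdense (fun a x y => by simp [hδ]) hcont
  let φ : G → UnitarySOT := fun a =>
    (Unitary.linearIsometryEquiv.symm ((e.symm.trans (π a)).trans e) :
      unitary (ellTwo →L[ℂ] ellTwo))
  let ev : UnitarySOT → ellTwo → ellTwo := fun u v =>
    ((show unitary (ellTwo →L[ℂ] ellTwo) from u) : ellTwo →L[ℂ] ellTwo) v
  have hev : ∀ a v, ev (φ a) v = e (π a (e.symm v)) := fun a v => rfl
  have hevind : Topology.IsInducing ev := ⟨rfl⟩
  have hevinj : Function.Injective ev := by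
    intro u v huv
    refine Subtype.ext (ContinuousLinearMap.ext fun x => congrFun huv x)
  have : T2Space UnitarySOT := T2Space.of_injective_continuous hevinj hevind.continuous
  have hφc : Continuous φ := by
    rw [hevind.continuous_iff]
    refine continuous_pi fun v => ?_
    exact e.continuous.comp (hπc _)
  let g : UnitarySOT → ellTwo := fun u => ev u (e (δ 0))
  have hgc : Continuous g := (continuous_apply _).comp hevind.continuous
  have hgφ : g ∘ φ = e ∘ δ := by
    ext1 a
    simp [g, hev, hπδ]
  have hemb : Topology.IsClosedEmbedding (g ∘ φ) := by
    rw [hgφ]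
    exact e.toHomeomorph.isClosedEmbedding.comp
      (hui.isUniformEmbedding.isClosedEmbedding)
  refine ⟨φ, fun a b => ?_, ?_, ?_, ?_⟩
  · apply hevinj
    ext1 v
    change e (π (a + b) (e.symm v)) = e (π a (e.symm (e (π b (e.symm v)))))
    rw [hπadd, e.symm_apply_apply]
  · exact hemb.injective.of_comp
  · exact Topology.IsInducing.of_comp hφc hgc hemb.isInducing
  · exact (isProperMap_of_comp_of_t2 hφc hgc hemb.isProperMap).isClosedMap.isClosed_range

end GNS

open scoped ENNReal in
theorem lp_separable (p : ℝ≥0∞) [Fact (1 ≤ p)] (htop : p ≠ ⊤) :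
    TopologicalSpace.SeparableSpace (lp (fun _ : ℕ => ℝ) p) := by
  rw [← TopologicalSpace.isSeparable_univ_iff]
  have h1 : TopologicalSpace.IsSeparable
      (Set.range fun n : ℕ => (lp.single p n (1 : ℝ) : lp (fun _ : ℕ => ℝ) p)) :=
    (Set.countable_range _).isSeparable
  refine ((h1.span (R := ℝ)).closure).mono fun x _ => ?_
  refine mem_closure_of_tendsto (lp.hasSum_single htop x) (Filter.Eventually.of_forall fun t => ?_)
  refine Submodule.sum_mem _ fun n _ => ?_
  have : (lp.single p n (x n) : lp (fun _ : ℕ => ℝ) p) = x n • lp.single p n (1 : ℝ) := by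
    rw [← lp.single_smul]; simp
  rw [this]
  exact Submodule.smul_mem _ _ (Submodule.subset_span ⟨n, rfl⟩)

open scoped ENNReal in
/-- Schoenberg's theorem applied to `ℓᵖ`, `1 ≤ p ≤ 2`: the function
`x ↦ exp (-‖x‖ᵖ)` is positive definite on the additive group of `ℓᵖ`, and
consequently the additive group of `ℓᵖ` is isomorphic to a closed topological
subgroup of the unitary group `U(ℓ²)` with the strong operator topology. -/
theorem schoenberg_lp_positive_definite_and_embedding
    (p : ℝ≥0∞) [Fact (1 ≤ p)] (hp2 : p ≤ 2) :
    (∀ (n : ℕ) (g : Fin n → lp (fun _ : ℕ => ℝ) p) (lam : Fin n → ℂ),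
      0 ≤ ∑ i, ∑ j, ((Real.exp (-(‖g i - g j‖ ^ p.toReal)) : ℝ) : ℂ) *
        lam i * (starRingEnd ℂ) (lam j)) ∧
    (∃ φ : lp (fun _ : ℕ => ℝ) p → UnitarySOT,
      (∀ a b, φ (a + b) = φ a * φ b) ∧
      Function.Injective φ ∧ Topology.IsInducing φ ∧ IsClosed (Set.range φ)) := by
  have htop : p ≠ ⊤ := ne_top_of_le_ne_top (by simp) hp2
  have h1 : 0 < p.toReal :=
    ENNReal.toReal_pos (lt_of_lt_of_le zero_lt_one (Fact.out : 1 ≤ p)).ne' htop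
  have hk := PK_lp p hp2
  refine ⟨fun n g lam => hk.fin n g lam, ?_⟩
  have := lp_separable p htop
  refine main_embedding h1 hk (fun n => lp.single p 0 (n : ℝ)) fun m n hmn => ?_
  rw [dist_eq_norm, ← lp.single_sub, lp.norm_single (zero_lt_one.trans_le Fact.out)]
  have : (1 : ℤ) ≤ |(m : ℤ) - n| := Int.one_le_abs (by omega)
  rw [Real.norm_eq_abs]
  exact_mod_cast this
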